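/- Let c ∈ (0, 1/3) and define F_c : [1,∞) → ℝ by F_c(ℓ) := limsup_{x→∞} #W(ℓ; y ↦ y^c; x) / (x / log x). Then the set of points ℓ ∈ [1,∞) at which F_c is discontinuous is dense in [1,∞). -/

import Mathlib

/-- `sigma1 n` is the sum of the positive divisors of `n`. -/
noncomputable def sigma1 (n : ℕ) : ℕ := ArithmeticFunction.sigma 1 n

lemma sig_prime_mul {p k : ℕ} (hp : p.Prime) (h : ¬ p ∣ k) :
    sigma1 (p * k) = (p + 1) * sigma1 k := by
  unfold sigma1
  rw [ArithmeticFunction.isMultiplicative_sigma.map_mul_of_coprime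
    ((Nat.Prime.coprime_iff_not_dvd hp).2 h)]
  congr 1
  have := ArithmeticFunction.sigma_one_apply_prime_pow (p := p) (i := 1) hp
  simpa [Finset.sum_range_succ, add_comm] using this

lemma sig_ge {k : ℕ} (hk : 1 ≤ k) : k ≤ sigma1 k := by
  unfold sigma1
  rw [ArithmeticFunction.sigma_one_apply]
  exact Finset.single_le_sum (f := fun d => d) (fun _ _ => Nat.zero_le _)
    (Nat.mem_divisors_self k (by omega))

/-- the counting set -/
def WW (c ℓ x : ℝ) : Set ℕ := {n : ℕ | 1 ≤ n ∧ (n : ℝ) ≤ x ∧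
            |(sigma1 n : ℝ) - ℓ * n| < (n : ℝ) ^ c}

lemma WW_sub (c ℓ x : ℝ) : WW c ℓ x ⊆ (Finset.Icc 1 ⌊x⌋₊ : Finset ℕ) := by
  intro n hn
  simp only [Finset.coe_Icc, Set.mem_Icc]
  exact ⟨hn.1, Nat.le_floor hn.2.1⟩

lemma WW_fin (c ℓ x : ℝ) : (WW c ℓ x).Finite :=
  (Finset.finite_toSet _).subset (WW_sub c ℓ x)

lemma ae_bound (c : ℝ) (hc' : c < 1 / 3) :
    ∀ᵐ ℓ : ℝ, ∃ C : ℝ, ∀ x : ℝ, 1 ≤ x → ((WW c ℓ x).ncard : ℝ) ≤ C * Real.sqrt x := by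
  let f : ℕ → ℝ → ENNReal := fun n =>
    (Metric.ball ((sigma1 n : ℝ) / n) ((n : ℝ) ^ (c - 1))).indicator
      (fun _ => ENNReal.ofReal ((n : ℝ) ^ (-(1/2) : ℝ)))
  have hfm : ∀ n, Measurable (f n) := fun n =>
    measurable_const.indicator Metric.isOpen_ball.measurableSet
  have hint : ∀ n, ∫⁻ ℓ, f n ℓ = ENNReal.ofReal (2 * (n : ℝ) ^ (c - 3/2)) := by
    intro n
    simp only [f]
    rw [MeasureTheory.lintegral_indicator Metric.isOpen_ball.measurableSet]
    simp only [MeasureTheory.lintegral_const, MeasureTheory.Measure.restrict_apply MeasurableSet.univ,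
      Set.univ_inter, Real.volume_ball]
    rw [← ENNReal.ofReal_mul (by positivity)]
    congr 1
    rcases Nat.eq_zero_or_pos n with h | h
    · subst h
      simp only [Nat.cast_zero]
      rw [Real.zero_rpow (x := -(1/2)) (by norm_num), Real.zero_rpow (x := c - 3/2) (by linarith)]; simp
    · have : (0:ℝ) < n := by exact_mod_cast h
      rw [show c - 3/2 = (-(1/2) : ℝ) + (c - 1) by ring, Real.rpow_add this]; ring
  have hsum : Summable (fun n : ℕ => 2 * (n : ℝ) ^ (c - 3/2)) :=
    (Real.summable_nat_rpow.2 (by linarith)).mul_left 2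
  have htot : ∫⁻ ℓ, ∑' n, f n ℓ ≠ ⊤ := by
    rw [MeasureTheory.lintegral_tsum (fun n => (hfm n).aemeasurable)]
    simp_rw [hint]
    exact hsum.tsum_ofReal_ne_top
  have hae := MeasureTheory.ae_lt_top (Measurable.tsum hfm) htot
  filter_upwards [hae] with ℓ hℓ
  refine ⟨(∑' n, f n ℓ).toReal, fun x hx => ?_⟩
  have hx0 : 0 < x := by linarith
  have hfin := WW_fin c ℓ x
  rw [Set.ncard_eq_toFinset_card _ hfin]
  have h1 : ∑ n ∈ hfin.toFinset, f n ℓ ≤ ∑' n, f n ℓ := ENNReal.sum_le_tsum _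
  have h2 : ∀ n ∈ hfin.toFinset, ENNReal.ofReal (x ^ (-(1/2) : ℝ)) ≤ f n ℓ := by
    intro n hn
    rw [Set.Finite.mem_toFinset] at hn
    obtain ⟨hn1, hn2, hn3⟩ := hn
    have hn0 : (0:ℝ) < n := by exact_mod_cast hn1
    have hmem : ℓ ∈ Metric.ball ((sigma1 n : ℝ) / n) ((n : ℝ) ^ (c - 1)) := by
      rw [Metric.mem_ball, dist_comm, Real.dist_eq]
      have : (sigma1 n : ℝ) / n - ℓ = ((sigma1 n : ℝ) - ℓ * n) / n := by field_simp
      rw [this, abs_div, abs_of_pos hn0, Real.rpow_sub_one hn0.ne']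
      gcongr
    simp only [f, Set.indicator_of_mem hmem]
    apply ENNReal.ofReal_le_ofReal
    exact Real.rpow_le_rpow_of_nonpos hn0 hn2 (by norm_num)
  have h3 := (Finset.card_nsmul_le_sum _ _ _ h2).trans h1
  have h4 := ENNReal.toReal_mono hℓ.ne h3
  rw [nsmul_eq_mul, ENNReal.toReal_mul, ENNReal.toReal_natCast,
    ENNReal.toReal_ofReal (by positivity)] at h4
  rw [Real.sqrt_eq_rpow]
  have h5 : x ^ (-(1/2) : ℝ) * x ^ (1/2 : ℝ) = 1 := by
    rw [← Real.rpow_add hx0]; norm_num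
  calc (hfin.toFinset.card : ℝ) = hfin.toFinset.card * x ^ (-(1/2) : ℝ) * x ^ (1/2 : ℝ) := by
        rw [mul_assoc, h5, mul_one]
    _ ≤ _ := by gcongr

lemma limsup_zero (c ℓ C : ℝ)
    (h : ∀ x : ℝ, 1 ≤ x → ((WW c ℓ x).ncard : ℝ) ≤ C * Real.sqrt x) :
    Filter.limsup (fun x : ℝ => ((WW c ℓ x).ncard : ℝ) / (x / Real.log x)) Filter.atTop = 0 := by
  apply Filter.Tendsto.limsup_eq
  have h0 : Filter.Tendsto (fun x : ℝ => C * (Real.log x / x ^ (1/2 : ℝ))) Filter.atTop (nhds 0) := by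
    have := (isLittleO_log_rpow_atTop (r := 1/2) (by norm_num)).tendsto_div_nhds_zero
    simpa using this.const_mul C
  refine tendsto_of_tendsto_of_tendsto_of_le_of_le' tendsto_const_nhds h0 ?_ ?_
  · filter_upwards [Filter.eventually_ge_atTop 1] with x hx
    have := Real.log_nonneg hx
    positivity
  · filter_upwards [Filter.eventually_gt_atTop 1] with x hx
    have hl := Real.log_pos hx
    have hx0 : 0 < x := by linarith
    have := h x hx.le
    rw [div_div_eq_mul_div, div_le_iff₀ hx0]
    have h5 : C * (Real.log x / x ^ (1/2 : ℝ)) * x = C * Real.sqrt x * Real.log x := by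
      rw [← Real.sqrt_eq_rpow]
      have := Real.sqrt_pos.2 hx0
      field_simp
      rw [Real.sq_sqrt hx0.le]
    rw [h5]
    gcongr

lemma sigma_dense (ℓ : ℝ) (hℓ : 1 ≤ ℓ) (ε : ℝ) (hε : 0 < ε) :
    ∃ m : ℕ, 1 ≤ m ∧ ℓ ≤ (sigma1 m : ℝ) / m ∧ (sigma1 m : ℝ) / m < ℓ + ε := by
  obtain ⟨y, hy⟩ := exists_nat_gt (ℓ / ε)
  have hy0 : (0:ℝ) < y := lt_of_le_of_lt (by positivity) hy
  let P : ℕ → ℕ := fun z => ∏ p ∈ (Finset.range z).filter (fun p => p.Prime ∧ y ≤ p), p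
  let f : ℕ → ℝ := fun z => (sigma1 (P z) : ℝ) / P z
  have hPpos : ∀ z, 1 ≤ P z := by
    intro z
    have : 0 < P z := Finset.prod_pos (fun p hp => by
      simp only [Finset.mem_filter] at hp; exact hp.2.1.pos)
    exact this
  have hstep1 : ∀ z, z.Prime ∧ y ≤ z → f (z + 1) = (1 + 1 / (z:ℝ)) * f z := by
    intro z hz
    have hP : P (z + 1) = z * P z := by
      simp only [P]
      rw [Finset.range_add_one, Finset.filter_insert, if_pos hz, Finset.prod_insert (by simp)]
    have hnd : ¬ z ∣ P z := by
      intro hd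
      rw [Prime.dvd_finsetProd_iff hz.1.prime] at hd
      obtain ⟨q, hq, hzq⟩ := hd
      simp only [Finset.mem_filter, Finset.mem_range] at hq
      exact absurd (Nat.le_of_dvd hq.2.1.pos hzq) (by omega)
    simp only [f]
    rw [hP, sig_prime_mul hz.1 hnd]
    have : (0:ℝ) < z := by exact_mod_cast hz.1.pos
    have : (0:ℝ) < P z := by exact_mod_cast hPpos z
    push_cast
    field_simp
  have hstep2 : ∀ z, ¬ (z.Prime ∧ y ≤ z) → f (z + 1) = f z := by
    intro z hz
    have hP : P (z + 1) = P z := by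
      simp only [P]
      rw [Finset.range_add_one, Finset.filter_insert, if_neg hz]
    simp only [f, hP]
  have hf0 : f 0 = 1 := by simp [f, P, sigma1]
  have hlow : ∀ z, 1 + ∑ p ∈ Finset.range z, (if p.Prime ∧ y ≤ p then (1 / (p:ℝ)) else 0) ≤ f z := by
    intro z
    induction z with
    | zero => simp [hf0]
    | succ z ih =>
      rw [Finset.sum_range_succ]
      have hnn : 0 ≤ ∑ p ∈ Finset.range z, (if p.Prime ∧ y ≤ p then (1 / (p:ℝ)) else 0) :=
        Finset.sum_nonneg (fun p _ => by split_ifs <;> positivity)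
      by_cases hz : z.Prime ∧ y ≤ z
      · rw [if_pos hz, hstep1 z hz]
        have : (0:ℝ) ≤ 1 / z := by positivity
        nlinarith
      · rw [if_neg hz, hstep2 z hz]; linarith
  have hex : ∃ z, ℓ ≤ f z := by
    by_contra! hcon
    apply not_summable_one_div_on_primes
    rw [← summable_nat_add_iff y]
    have : Summable (fun p : ℕ => (if p.Prime ∧ y ≤ p then (1 / (p:ℝ)) else 0)) := by
      apply summable_of_sum_range_le (c := ℓ)
      · intro p; split_ifs <;> positivity
      · intro z; linarith [hlow z, hcon z]
    refine ((summable_nat_add_iff y).2 this).congr (fun p => ?_)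
    by_cases hp : (p + y).Prime
    · rw [if_pos ⟨hp, by omega⟩, Set.indicator_of_mem (by exact hp)]
    · rw [if_neg (fun h => hp h.1), Set.indicator_of_notMem (by exact hp)]
  classical
  let z := Nat.find hex
  have hz : ℓ ≤ f z := Nat.find_spec hex
  refine ⟨P z, hPpos z, hz, ?_⟩
  change f z < ℓ + ε
  rcases Nat.eq_zero_or_pos z with h0 | hpos
  · rw [h0, hf0]; linarith
  · obtain ⟨w, hw⟩ := Nat.exists_eq_succ_of_ne_zero hpos.ne'
    have hlt : f w < ℓ := not_le.1 (Nat.find_min hex (m := w) (by omega))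
    rw [hw]
    change f (w + 1) < _
    by_cases hwp : w.Prime ∧ y ≤ w
    · rw [hstep1 w hwp]
      have hw0 : (0:ℝ) < w := by exact_mod_cast hwp.1.pos
      have hyw : (y:ℝ) ≤ w := by exact_mod_cast hwp.2
      have h1 : ℓ / w < ε := by
        rw [div_lt_iff₀ hw0]
        rw [div_lt_iff₀ hε] at hy
        nlinarith
      calc (1 + 1 / (w:ℝ)) * f w < (1 + 1 / (w:ℝ)) * ℓ := by gcongr
        _ = ℓ + ℓ / w := by ring
        _ < _ := by linarith
    · rw [hstep2 w hwp]; linarith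

lemma lower_bound (c : ℝ) (hc : 0 < c) (m : ℕ) (hm : 1 ≤ m) :
    ∃ δ : ℝ, 0 < δ ∧ ∀ᶠ x : ℝ in Filter.atTop,
      δ ≤ ((WW c ((sigma1 m : ℝ) / m) x).ncard : ℝ) / (x / Real.log x) := by
  have hm0 : (0:ℝ) < m := by exact_mod_cast hm
  have hm1 : (1:ℝ) ≤ m := by exact_mod_cast hm
  obtain ⟨K, hK⟩ := exists_nat_gt (max (m:ℝ) ((sigma1 m : ℝ) ^ (1 / c)))
  have hKm : m < K := by exact_mod_cast (le_max_left _ _).trans_lt hK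
  have hKs : (sigma1 m : ℝ) ^ (1 / c) < K := (le_max_right _ _).trans_lt hK
  refine ⟨1 / (2 * m), by positivity, ?_⟩
  have hlo : ∀ᶠ x : ℝ in Filter.atTop, Real.log x ≤ (0.05 / (m * (2 + K))) * x := by
    have := (Real.isLittleO_log_id_atTop).bound (c := 0.05 / (m * (2 + K))) (by positivity)
    filter_upwards [this, Filter.eventually_ge_atTop 1] with x h hx
    rw [Real.norm_eq_abs, Real.norm_eq_abs, abs_of_nonneg (Real.log_nonneg hx), id,
      abs_of_nonneg (by linarith)] at h
    exact h
  filter_upwards [hlo, Filter.eventually_gt_atTop (10 * m : ℝ), Filter.eventually_gt_atTop (3:ℝ)]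
    with x hx hxm hx3
  have hx0 : 0 < x := by linarith
  have hlx : 0 < Real.log x := Real.log_pos (by linarith)
  set y := x / m with hy
  have hy10 : 10 < y := by rw [hy, lt_div_iff₀ hm0]; exact hxm
  have hyx : y ≤ x := by rw [hy]; exact div_le_self hx0.le hm1
  have hpi := Chebyshev.pi_ge' (x := y) (by linarith)
  have hly : 0 < Real.log y := Real.log_pos (by linarith)
  have hlyx : Real.log y ≤ Real.log x := Real.log_le_log (by linarith) hyx
  have hly2 : Real.log (y + 2) ≤ 2 * Real.log x := by
    have : 2 * Real.log x = Real.log (x ^ 2) := by rw [Real.log_pow]; norm_num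
    rw [this]
    exact Real.log_le_log (by linarith) (by nlinarith)
  rw [div_le_iff₀ hly] at hpi
  have hpi2 : (y - 1) * Real.log 2 - 2 * Real.log x ≤ (Nat.primeCounting ⌊y⌋₊ : ℝ) * Real.log x := by
    have : (Nat.primeCounting ⌊y⌋₊ : ℝ) * Real.log y ≤ Nat.primeCounting ⌊y⌋₊ * Real.log x := by
      gcongr
    linarith
  -- counting
  have hcard : (Nat.primeCounting ⌊y⌋₊ : ℝ) - (K + 1) ≤ ((WW c ((sigma1 m : ℝ) / m) x).ncard : ℝ) := by
    let S : Finset ℕ := (Nat.primesLE ⌊y⌋₊) \ (Finset.range (K + 1))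
    have hS : Nat.primeCounting ⌊y⌋₊ ≤ S.card + (K + 1) := by
      have h1 := Finset.le_card_sdiff (Finset.range (K + 1)) (Nat.primesLE ⌊y⌋₊)
      rw [Finset.card_range] at h1
      have h2 : (Nat.primesLE ⌊y⌋₊).card = Nat.primeCounting ⌊y⌋₊ := by simp
      simp only [S]
      omega
    have hinj : Function.Injective (fun p : ℕ => p * m) := fun a b h =>
      Nat.eq_of_mul_eq_mul_right (by omega) h
    have hsub : ((S.image (fun p : ℕ => p * m) : Finset ℕ) : Set ℕ) ⊆ WW c ((sigma1 m : ℝ) / m) x := by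
      intro n hn
      simp only [Finset.coe_image, Set.mem_image, Finset.mem_coe, S, Finset.mem_sdiff,
        Nat.mem_primesLE, Finset.mem_range] at hn
      obtain ⟨p, ⟨⟨hpy, hp⟩, hpK⟩, rfl⟩ := hn
      have hpK' : K < p := by omega
      have hp0 : (0:ℝ) < p := by exact_mod_cast hp.pos
      have hnd : ¬ p ∣ m := fun h => absurd (Nat.le_of_dvd (by omega) h) (by omega)
      refine ⟨Nat.mul_pos hp.pos (by omega), ?_, ?_⟩
      · have : (p:ℝ) ≤ y := (Nat.le_floor_iff (by linarith)).1 hpy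
        rw [hy, le_div_iff₀ hm0] at this
        push_cast; exact this
      · rw [sig_prime_mul hp hnd]
        push_cast
        have h1 : ((p:ℝ) + 1) * sigma1 m - (sigma1 m : ℝ) / m * (p * m) = sigma1 m := by
          field_simp; ring
        rw [h1, abs_of_nonneg (by positivity)]
        calc (sigma1 m : ℝ) = ((sigma1 m : ℝ) ^ (1 / c)) ^ c := by
              rw [← Real.rpow_mul (by positivity), one_div, inv_mul_cancel₀ hc.ne', Real.rpow_one]
          _ < (p * m : ℝ) ^ c := by
              apply Real.rpow_lt_rpow (by positivity) _ hc
              have : (K:ℝ) < p := by exact_mod_cast hpK'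
              nlinarith
    have h3 := Set.ncard_le_ncard hsub (WW_fin _ _ _)
    rw [Set.ncard_coe_finset, Finset.card_image_of_injective _ hinj] at h3
    have h4 : Nat.primeCounting ⌊y⌋₊ ≤ (WW c ((sigma1 m : ℝ) / m) x).ncard + (K + 1) := by omega
    have : (Nat.primeCounting ⌊y⌋₊ : ℝ) ≤ (WW c ((sigma1 m : ℝ) / m) x).ncard + (K + 1) := by
      exact_mod_cast h4
    linarith
  rw [div_div_eq_mul_div, le_div_iff₀ hx0]
  have h5 : 1 / (2 * (m:ℝ)) * x = y / 2 := by rw [hy]; field_simp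
  rw [h5]
  have h6 : (2 + (K:ℝ)) * Real.log x ≤ 0.05 * y := by
    calc (2 + (K:ℝ)) * Real.log x ≤ (2 + (K:ℝ)) * ((0.05 / (m * (2 + K))) * x) := by gcongr
      _ = 0.05 * y := by rw [hy]; field_simp
  have hl2 := Real.log_two_gt_d9
  have h7 : ((Nat.primeCounting ⌊y⌋₊ : ℝ) - (K + 1)) * Real.log x ≤
      ((WW c ((sigma1 m : ℝ) / m) x).ncard : ℝ) * Real.log x := by gcongr
  have h8 : 0.69 * (y - 1) ≤ (y - 1) * Real.log 2 := by nlinarith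
  have h9 : Real.log x ≤ (2 + (K:ℝ)) * Real.log x := by nlinarith [(Nat.cast_nonneg K : (0:ℝ) ≤ K)]
  have hKK : (0:ℝ) ≤ K := Nat.cast_nonneg K
  nlinarith

/-- a largest prime factor, at least one -/
def PP (k : ℕ) : ℕ := max 1 (k.primeFactors.sup id)

lemma PP_ge {k q : ℕ} (hk : k ≠ 0) (hq : q.Prime) (h : q ∣ k) : q ≤ PP k := by
  unfold PP
  refine le_trans ?_ (le_max_right _ _)
  exact Finset.le_sup (f := id) (Nat.mem_primeFactors.2 ⟨hq, h, hk⟩)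

lemma PP_pos (k : ℕ) : 1 ≤ PP k := le_max_left _ _

lemma PP_prime {k : ℕ} (hk : 2 ≤ k) : (PP k).Prime ∧ PP k ∣ k := by
  have hne : k.primeFactors.Nonempty := Nat.nonempty_primeFactors.2 hk
  obtain ⟨q, hq, hq2⟩ := Finset.exists_mem_eq_sup k.primeFactors hne id
  have hq' := Nat.mem_primeFactors.1 hq
  have : PP k = q := by
    unfold PP
    rw [hq2]
    exact max_eq_right hq'.1.one_le
  rw [this]
  exact ⟨hq'.1, hq'.2.1⟩

lemma euler_sq (k : ℕ) (hk : 1 ≤ k) :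
    (∏ p ∈ (2 * k).primesBelow, (1 - (p:ℝ)⁻¹)⁻¹) ^ 2 ≤ 4 * (2 * k - 1) ∧
    0 ≤ ∏ p ∈ (2 * k).primesBelow, (1 - (p:ℝ)⁻¹)⁻¹ := by
  refine ⟨?_, Finset.prod_nonneg (fun p hp => ?_)⟩
  swap
  · have : (1:ℝ) ≤ p := by exact_mod_cast (Nat.prime_of_mem_primesBelow hp).one_le
    have := inv_le_one_of_one_le₀ this
    exact inv_nonneg.2 (by linarith)
  induction k, hk using Nat.le_induction with
  | base =>
    have : (2 * 1).primesBelow = ∅ := by decide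
    rw [this]; norm_num
  | succ k hk ih =>
    rcases Nat.eq_or_lt_of_le hk with h1 | h1
    · subst h1
      have : (2 * (1 + 1)).primesBelow = {2, 3} := by decide
      rw [this]; norm_num
    · have hne : ¬ (2 * k).Prime := Nat.not_prime_mul (by omega) (by omega)
      rw [show 2 * (k + 1) = (2 * k + 1) + 1 by ring, Nat.primesBelow_succ, Nat.primesBelow_succ,
        if_neg hne]
      have hk1 : (2:ℝ) ≤ k := by exact_mod_cast h1
      split_ifs with hp
      · rw [Finset.prod_insert (by simp [Nat.mem_primesBelow])]
        rw [mul_pow]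
        have h2 : (1 - ((2 * k + 1 : ℕ) : ℝ)⁻¹)⁻¹ = (2 * k + 1) / (2 * k) := by
          push_cast
          rw [inv_eq_iff_eq_inv, inv_div]
          field_simp
          ring
        rw [h2, div_pow]
        calc ((2 * (k:ℝ) + 1)) ^ 2 / (2 * k) ^ 2 * _
            ≤ ((2 * (k:ℝ) + 1)) ^ 2 / (2 * k) ^ 2 * (4 * (2 * k - 1)) := by gcongr
          _ ≤ _ := by
            rw [div_mul_eq_mul_div, div_le_iff₀ (by positivity)]
            push_cast
            nlinarith
      · push_cast
        linarith

lemma smooth_sum (q : ℕ) (hq : 1 ≤ q) (J : Finset ℕ) (hJ : ∀ j ∈ J, j ∈ (q + 1).smoothNumbers) :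
    ∑ j ∈ J, (j:ℝ)⁻¹ ≤ 3 * Real.sqrt q := by
  let f : ℕ →* ℝ :=
    { toFun := fun n => (n:ℝ)⁻¹
      map_one' := by simp
      map_mul' := fun a b => by push_cast; rw [mul_inv] }
  have hf : ∀ n, f n = (n:ℝ)⁻¹ := fun n => rfl
  have h := EulerProduct.summable_and_hasSum_smoothNumbers_prod_primesBelow_geometric (f := f)
    (fun {p} hp => by
      rw [hf, norm_inv]
      have : (1:ℝ) < p := by exact_mod_cast hp.one_lt
      rw [Real.norm_of_nonneg (by positivity)]
      exact inv_lt_one_of_one_lt₀ this) (2 * q)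
  have h1 : ∑ j ∈ J, (j:ℝ)⁻¹ ≤ ∏ p ∈ (2 * q).primesBelow, (1 - (p:ℝ)⁻¹)⁻¹ := by
    have hJ' : ∀ j ∈ J, j ∈ (2 * q).smoothNumbers := fun j hj =>
      Nat.smoothNumbers_mono (by omega) (hJ j hj)
    have h2 := sum_le_hasSum (J.attach.map ⟨fun j => (⟨j.1, hJ' j.1 j.2⟩ : (2 * q).smoothNumbers),
      fun a b hab => by
        apply Subtype.ext
        simpa using hab⟩) (fun i _ => by rw [hf]; positivity) h.2
    rw [Finset.sum_map] at h2
    simp only [hf] at h2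
    rw [← Finset.sum_attach J (fun j => (j:ℝ)⁻¹)]
    exact h2
  refine h1.trans ?_
  obtain ⟨h3, h4⟩ := euler_sq q hq
  apply abs_le_of_sq_le_sq' _ (by positivity) |>.2
  rw [mul_pow, Real.sq_sqrt (by positivity)]
  have : (1:ℝ) ≤ q := by exact_mod_cast hq
  linarith

lemma summable_PP : Summable (fun k : ℕ => ((k:ℝ) * PP k)⁻¹) := by
  have hs : Summable (fun q : ℕ => 3 * (q:ℝ) ^ (-(3/2) : ℝ)) :=
    (Real.summable_nat_rpow.2 (by norm_num)).mul_left 3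
  apply summable_of_sum_le (c := 1 + ∑' q : ℕ, 3 * (q:ℝ) ^ (-(3/2) : ℝ))
  · intro k; positivity
  intro u
  have hsplit : ∑ k ∈ u, ((k:ℝ) * PP k)⁻¹ ≤ 1 + ∑ k ∈ u.filter (fun k => 2 ≤ k), ((k:ℝ) * PP k)⁻¹ := by
    rw [← Finset.sum_filter_add_sum_filter_not u (fun k => 2 ≤ k), add_comm]
    gcongr
    calc ∑ k ∈ u.filter (fun k => ¬ 2 ≤ k), ((k:ℝ) * PP k)⁻¹
        ≤ ∑ k ∈ Finset.range 2, ((k:ℝ) * PP k)⁻¹ := by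
          apply Finset.sum_le_sum_of_subset_of_nonneg
          · intro k hk
            simp only [Finset.mem_filter, Finset.mem_range] at *
            omega
          · intros; positivity
      _ ≤ 1 := by simp [Finset.sum_range_succ, PP]
  refine hsplit.trans ?_
  gcongr
  set v := u.filter (fun k => 2 ≤ k) with hv
  have hv2 : ∀ k ∈ v, 2 ≤ k := fun k hk => (Finset.mem_filter.1 hk).2
  rw [← Finset.sum_fiberwise_of_maps_to (t := v.image PP) (g := PP)
    (fun k hk => Finset.mem_image_of_mem _ hk)]
  refine le_trans ?_ (hs.sum_le_tsum (v.image PP) (fun q _ => by positivity))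
  apply Finset.sum_le_sum
  intro q hq
  have hqp : q.Prime := by
    obtain ⟨k, hk, rfl⟩ := Finset.mem_image.1 hq
    exact (PP_prime (hv2 k hk)).1
  have hq0 : (0:ℝ) < q := by exact_mod_cast hqp.pos
  have key : ∀ k ∈ v.filter (fun k => PP k = q), k / q * q = k := by
    intro k hk
    simp only [Finset.mem_filter] at hk
    exact Nat.div_mul_cancel (hk.2 ▸ (PP_prime (hv2 k hk.1)).2)
  have h1 : ∑ k ∈ v.filter (fun k => PP k = q), ((k:ℝ) * PP k)⁻¹ =
      ((q:ℝ) ^ 2)⁻¹ * ∑ j ∈ (v.filter (fun k => PP k = q)).image (fun k => k / q), (j:ℝ)⁻¹ := by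
    rw [Finset.sum_image, Finset.mul_sum]
    · apply Finset.sum_congr rfl
      intro k hk
      have h2 := key k hk
      have h3 : (k:ℝ) = ((k / q : ℕ) : ℝ) * q := by exact_mod_cast h2.symm
      simp only [Finset.mem_filter] at hk
      rw [hk.2, h3, ← mul_inv]
      congr 1
      rw [← h3]
      rw [h3]; ring
    · intro a ha b hb hab
      simp only at hab
      rw [← key a ha, ← key b hb, hab]
  rw [h1]
  have h4 := smooth_sum q hqp.one_le ((v.filter (fun k => PP k = q)).image (fun k => k / q)) (by
    intro j hj
    obtain ⟨k, hk, rfl⟩ := Finset.mem_image.1 hj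
    have hkk := key k hk
    simp only [Finset.mem_filter] at hk
    have hk2 := hv2 k hk.1
    rw [Nat.mem_smoothNumbers']
    intro r hr hrd
    have : r ≤ PP k := PP_ge (by omega) hr (hrd.trans ⟨q, hkk.symm⟩)
    omega)
  calc ((q:ℝ) ^ 2)⁻¹ * _ ≤ ((q:ℝ) ^ 2)⁻¹ * (3 * Real.sqrt q) := by gcongr
    _ = 3 * (q:ℝ) ^ (-(3/2) : ℝ) := by
      rw [Real.sqrt_eq_rpow, ← Real.rpow_natCast, ← Real.rpow_neg hq0.le]
      rw [mul_left_comm, ← Real.rpow_add hq0]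
      norm_num

lemma sumA : ∃ B : ℝ, 0 ≤ B ∧ ∀ A : Finset ℕ, (∀ a ∈ A, 1 ≤ a) →
    (∀ k p q : ℕ, p.Prime → q.Prime → ¬ p ∣ k → ¬ q ∣ k → p * k ∈ A → q * k ∈ A → p = q) →
    ∑ a ∈ A, (a:ℝ)⁻¹ ≤ B := by
  set S := ∑' k : ℕ, ((k:ℝ) * PP k)⁻¹ with hS
  have hS0 : 0 ≤ S := tsum_nonneg (fun k => by positivity)
  refine ⟨1 + (S + S), by linarith, fun A hA1 hA => ?_⟩
  have hsplit : ∑ a ∈ A, (a:ℝ)⁻¹ ≤ 1 + ∑ a ∈ A.filter (fun k => 2 ≤ k), (a:ℝ)⁻¹ := by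
    rw [← Finset.sum_filter_add_sum_filter_not A (fun k => 2 ≤ k), add_comm]
    gcongr
    calc ∑ k ∈ A.filter (fun k => ¬ 2 ≤ k), (k:ℝ)⁻¹
        ≤ ∑ k ∈ ({1} : Finset ℕ), (k:ℝ)⁻¹ := by
          apply Finset.sum_le_sum_of_subset_of_nonneg
          · intro k hk
            simp only [Finset.mem_filter, Finset.mem_singleton] at *
            have := hA1 k hk.1
            omega
          · intros; positivity
      _ ≤ 1 := by simp
  refine hsplit.trans ?_
  gcongr
  set v := A.filter (fun k => 2 ≤ k) with hv
  have hv2 : ∀ k ∈ v, 2 ≤ k := fun k hk => (Finset.mem_filter.1 hk).2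
  have hvA : ∀ k ∈ v, k ∈ A := fun k hk => (Finset.mem_filter.1 hk).1
  have key : ∀ a ∈ v, PP a * (a / PP a) = a := fun a ha => Nat.mul_div_cancel' (PP_prime (hv2 a ha)).2
  have keypos : ∀ a ∈ v, a / PP a ≠ 0 := by
    intro a ha h0
    have := key a ha
    have := hv2 a ha
    rw [h0] at *
    omega
  have gen : ∀ s ⊆ v, Set.InjOn (fun a => a / PP a) (s : Set ℕ) → ∑ a ∈ s, (a:ℝ)⁻¹ ≤ S := by
    intro s hs hinj
    calc ∑ a ∈ s, (a:ℝ)⁻¹ ≤ ∑ a ∈ s, (((a / PP a : ℕ):ℝ) * PP (a / PP a))⁻¹ := by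
          apply Finset.sum_le_sum
          intro a ha
          have h1 := key a (hs ha)
          have h0 := keypos a (hs ha)
          have h2 : PP (a / PP a) ≤ PP a := by
            unfold PP
            apply max_le_max le_rfl
            apply Finset.sup_mono
            apply Nat.primeFactors_mono _ (by have := hv2 a (hs ha); omega)
            exact Nat.div_dvd_of_dvd (PP_prime (hv2 a (hs ha))).2
          have h3 : (a:ℝ) = ((a / PP a : ℕ):ℝ) * PP a := by
            exact_mod_cast (by rw [mul_comm]; exact h1.symm)
          have h4 : (0:ℝ) < ((a / PP a : ℕ):ℝ) := by exact_mod_cast Nat.pos_of_ne_zero h0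
          have h5 : (0:ℝ) < PP (a / PP a) := by exact_mod_cast PP_pos _
          calc (a:ℝ)⁻¹ = (((a / PP a : ℕ):ℝ) * PP a)⁻¹ := by rw [← h3]
            _ ≤ _ := by gcongr
      _ = ∑ k ∈ s.image (fun a => a / PP a), ((k:ℝ) * PP k)⁻¹ := by
          rw [Finset.sum_image hinj]
      _ ≤ S := summable_PP.sum_le_tsum _ (fun _ _ => by positivity)
  rw [← Finset.sum_filter_add_sum_filter_not v (fun a => PP a ∣ a / PP a)]
  apply add_le_add
  · apply gen _ (Finset.filter_subset _ _)
    intro a ha b hb hab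
    simp only [Finset.coe_filter, Set.mem_ofPred_eq] at ha hb hab
    have h : ∀ a ∈ v, PP a ∣ a / PP a → PP a = PP (a / PP a) := by
      intro a ha h
      apply le_antisymm
      · exact PP_ge (keypos a ha) (PP_prime (hv2 a ha)).1 h
      · unfold PP
        apply max_le_max le_rfl
        apply Finset.sup_mono
        apply Nat.primeFactors_mono _ (by have := hv2 a ha; omega)
        exact Nat.div_dvd_of_dvd (PP_prime (hv2 a ha)).2
    have hP : PP a = PP b := by rw [h a ha.1 ha.2, h b hb.1 hb.2, hab]
    calc a = PP a * (a / PP a) := (key a ha.1).symm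
      _ = PP b * (b / PP b) := by rw [hab, hP]
      _ = b := key b hb.1
  · apply gen _ (Finset.filter_subset _ _)
    intro a ha b hb hab
    simp only [Finset.coe_filter, Set.mem_ofPred_eq] at ha hb hab
    have := hA (a / PP a) (PP a) (PP b) (PP_prime (hv2 a ha.1)).1 (PP_prime (hv2 b hb.1)).1
      ha.2 (hab ▸ hb.2) (by rw [key a ha.1]; exact hvA a ha.1)
      (by rw [hab, key b hb.1]; exact hvA b hb.1)
    rw [← key a ha.1, ← key b hb.1, hab, this]

lemma pi_upper {y : ℝ} (hy : 1 < y) : (Nat.primeCounting ⌊y⌋₊ : ℝ) ≤ 5 * y / Real.log y := by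
  have h := Chebyshev.pi_le_log4_mul_div hy
  have hy0 : 0 < y := by linarith
  have hl : 0 < Real.log y := Real.log_pos hy
  have hs : 0 < Real.sqrt y := Real.sqrt_pos.2 hy0
  have hls : Real.log (Real.sqrt y) = Real.log y / 2 := Real.log_sqrt hy0.le
  have h1 : Real.log y / 2 ≤ Real.sqrt y := by
    rw [← hls]
    linarith [Real.log_le_sub_one_of_pos hs]
  have h4 : Real.log 4 ≤ 1.4 := by
    rw [show (4:ℝ) = 2 ^ 2 by norm_num, Real.log_pow]
    have := Real.log_two_lt_d9
    norm_num
    linarith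
  rw [hls] at h
  refine h.trans ?_
  rw [le_div_iff₀ hl, add_mul]
  have h5 : Real.log 4 * y / (Real.log y / 2) * Real.log y = 2 * Real.log 4 * y := by
    field_simp
  rw [h5]
  have h6 : Real.sqrt y * Real.log y ≤ 2 * y := by
    have := Real.mul_self_sqrt hy0.le
    nlinarith
  nlinarith

lemma sdiv_prime {p k : ℕ} (hp : p.Prime) (h : ¬ p ∣ k) (hk : 1 ≤ k) :
    (sigma1 (p * k) : ℝ) / ((p * k : ℕ) : ℝ) = (1 + 1 / (p:ℝ)) * ((sigma1 k : ℝ) / k) := by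
  rw [sig_prime_mul hp h]
  have : (0:ℝ) < p := by exact_mod_cast hp.pos
  have : (0:ℝ) < k := by exact_mod_cast hk
  push_cast
  field_simp

lemma sdiv_ge {k : ℕ} (hk : 1 ≤ k) : 1 ≤ (sigma1 k : ℝ) / k := by
  have : (0:ℝ) < k := by exact_mod_cast hk
  rw [le_div_iff₀ this, one_mul]
  exact_mod_cast sig_ge hk

lemma uniq_lt {ℓ ω D : ℝ} {k p q : ℕ} (hk : 1 ≤ k) (hp : p.Prime) (hq : q.Prime)
    (hpk : ¬ p ∣ k) (hqk : ¬ q ∣ k)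
    (h1 : |(sigma1 (p * k) : ℝ) / ((p * k : ℕ) : ℝ) - ℓ| ≤ ω)
    (h2 : |(sigma1 (q * k) : ℝ) / ((q * k : ℕ) : ℝ) - ℓ| ≤ ω)
    (hqD : (q:ℝ) ≤ D) (hD : 2 * ω * D ^ 2 < 1) : ¬ p < q := by
  intro hlt
  rw [sdiv_prime hp hpk hk] at h1
  rw [sdiv_prime hq hqk hk] at h2
  have hs := sdiv_ge hk
  set s := (sigma1 k : ℝ) / k
  have hp0 : (0:ℝ) < p := by exact_mod_cast hp.pos
  have hq0 : (0:ℝ) < q := by exact_mod_cast hq.pos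
  have hpq : (p:ℝ) + 1 ≤ q := by exact_mod_cast hlt
  rw [abs_le] at h1 h2
  have h3 : s * (1 / (p:ℝ) - 1 / q) ≤ 2 * ω := by linarith [h1.2, h2.1]
  have h4 : 1 / (D ^ 2) ≤ 1 / (p:ℝ) - 1 / q := by
    rw [div_sub_div _ _ hp0.ne' hq0.ne']
    apply div_le_div₀ (by linarith) (by linarith) (by positivity)
    nlinarith
  have hD0 : 0 < D := by linarith
  have h5 : 1 / D ^ 2 ≤ 2 * ω := by
    have : 0 ≤ 1 / D ^ 2 := by positivity
    nlinarith
  rw [div_le_iff₀ (by positivity)] at h5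
  linarith

lemma uniq {ℓ ω D : ℝ} {k p q : ℕ} (hk : 1 ≤ k) (hp : p.Prime) (hq : q.Prime)
    (hpk : ¬ p ∣ k) (hqk : ¬ q ∣ k)
    (h1 : |(sigma1 (p * k) : ℝ) / ((p * k : ℕ) : ℝ) - ℓ| ≤ ω)
    (h2 : |(sigma1 (q * k) : ℝ) / ((q * k : ℕ) : ℝ) - ℓ| ≤ ω)
    (hpD : (p:ℝ) ≤ D) (hqD : (q:ℝ) ≤ D) (hD : 2 * ω * D ^ 2 < 1) : p = q := by
  have a := uniq_lt hk hp hq hpk hqk h1 h2 hqD hD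
  have b := uniq_lt hk hq hp hqk hpk h2 h1 hpD hD
  omega

lemma card_W1 {ℓ r x Z : ℝ} {T : ℕ} (hT : 1 ≤ T) (hx : 0 < x) (hr : 2 * r * Z ^ 2 < 1) (S : Finset ℕ)
    (hS : ∀ n ∈ S, 1 ≤ n ∧ (n:ℝ) ≤ x ∧ |(sigma1 n : ℝ) / n - ℓ| ≤ r ∧
      ∃ p : ℕ, p.Prime ∧ T ≤ p ∧ (p:ℝ) ≤ Z ∧ p ∣ n ∧ ¬ p ∣ n / p) :
    (S.card : ℝ) ≤ x / T := by
  choose! h1 h2 h3 P hP using hS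
  have key : ∀ n ∈ S, P n * (n / P n) = n := fun n hn => Nat.mul_div_cancel' (hP n hn).2.2.2.1
  have kpos : ∀ n ∈ S, 1 ≤ n / P n := fun n hn =>
    Nat.div_pos (Nat.le_of_dvd (h1 n hn) (hP n hn).2.2.2.1) (hP n hn).1.pos
  have hinj : Set.InjOn (fun n => n / P n) (S : Set ℕ) := by
    intro a ha b hb hab
    simp only at hab
    have ha' := hP a ha
    have hb' := hP b hb
    have : P a = P b := by
      refine uniq (k := a / P a) (ℓ := ℓ) (ω := r) (D := Z) (kpos a ha) ha'.1 hb'.1 ha'.2.2.2.2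
        (hab ▸ hb'.2.2.2.2) ?_ ?_ ha'.2.2.1 hb'.2.2.1 hr
      · rw [key a ha]; exact h3 a ha
      · rw [hab, key b hb]; exact h3 b hb
    calc a = P a * (a / P a) := (key a ha).symm
      _ = P b * (b / P b) := by rw [hab, this]
      _ = b := key b hb
  have hT0 : (0:ℝ) < T := by exact_mod_cast hT
  have hsub : S.image (fun n => n / P n) ⊆ Finset.Icc 1 ⌊x / T⌋₊ := by
    intro k hk
    obtain ⟨n, hn, rfl⟩ := Finset.mem_image.1 hk
    rw [Finset.mem_Icc]
    refine ⟨kpos n hn, Nat.le_floor ?_⟩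
    rw [le_div_iff₀ hT0]
    refine le_trans ?_ (h2 n hn)
    have : n / P n * T ≤ n := by
      calc n / P n * T ≤ n / P n * P n := Nat.mul_le_mul_left _ (hP n hn).2.1
        _ = n := by rw [mul_comm]; exact key n hn
    exact_mod_cast this
  have h4 := Finset.card_le_card hsub
  rw [Finset.card_image_of_injOn hinj, Nat.card_Icc] at h4
  calc (S.card : ℝ) ≤ ⌊x / T⌋₊ := by exact_mod_cast (by omega)
    _ ≤ x / T := Nat.floor_le (by positivity)

lemma card_W2 {x : ℝ} {T : ℕ} (hT : 1 ≤ T) (hx : 0 < x) (S : Finset ℕ)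
    (hS : ∀ n ∈ S, 1 ≤ n ∧ (n:ℝ) ≤ x ∧ ∃ p : ℕ, T ≤ p ∧ p ^ 2 ∣ n) :
    (S.card : ℝ) ≤ 2 * x / T := by
  have hsub : S ⊆ (Finset.Ioo (T - 1) (⌊x⌋₊ + 1)).biUnion
      (fun p => (Finset.Ioc 0 ⌊x⌋₊).filter (fun n => p ^ 2 ∣ n)) := by
    intro n hn
    obtain ⟨h1, h2, p, hp, hpn⟩ := hS n hn
    have hnx : n ≤ ⌊x⌋₊ := Nat.le_floor h2
    have h3 : p ^ 2 ≤ n := Nat.le_of_dvd h1 hpn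
    have h4 : p ≤ p ^ 2 := Nat.le_self_pow (by norm_num) p
    simp only [Finset.mem_biUnion, Finset.mem_Ioo, Finset.mem_filter, Finset.mem_Ioc]
    exact ⟨p, ⟨by omega, by omega⟩, ⟨by omega, hnx⟩, hpn⟩
  have h1 := (Finset.card_le_card hsub).trans Finset.card_biUnion_le
  simp only [Nat.Ioc_filter_dvd_card_eq_div] at h1
  have h2 : (S.card : ℝ) ≤ ∑ p ∈ Finset.Ioo (T - 1) (⌊x⌋₊ + 1), ((⌊x⌋₊ / p ^ 2 : ℕ) : ℝ) := by
    exact_mod_cast h1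
  have hT0 : (0:ℝ) < T := by exact_mod_cast hT
  calc (S.card : ℝ) ≤ _ := h2
    _ ≤ ∑ p ∈ Finset.Ioo (T - 1) (⌊x⌋₊ + 1), x * ((p:ℝ) ^ 2)⁻¹ := by
      apply Finset.sum_le_sum
      intro p _
      refine Nat.cast_div_le.trans ?_
      rw [div_eq_mul_inv]
      push_cast
      gcongr
      exact Nat.floor_le hx.le
    _ = x * ∑ p ∈ Finset.Ioo (T - 1) (⌊x⌋₊ + 1), ((p:ℝ) ^ 2)⁻¹ := by rw [Finset.mul_sum]
    _ ≤ x * (2 / ((T - 1 : ℕ) + 1)) := by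
      gcongr
      exact sum_Ioo_inv_sq_le _ _
    _ = 2 * x / T := by
      rw [Nat.cast_sub hT]; push_cast; rw [sub_add_cancel]; ring

lemma card_W4 {ℓ ω x Z L B : ℝ} {T : ℕ} (hZ : 1 < Z) (hL : 0 < L) (hLZ : L / 3 ≤ Real.log Z)
    (hx : 0 < x)
    (hω : 2 * ω * (T:ℝ) ^ 2 < 1)
    (hB : ∀ A : Finset ℕ, (∀ a ∈ A, 1 ≤ a) →
    (∀ k p q : ℕ, p.Prime → q.Prime → ¬ p ∣ k → ¬ q ∣ k → p * k ∈ A → q * k ∈ A → p = q) →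
    ∑ a ∈ A, (a:ℝ)⁻¹ ≤ B) (S : Finset ℕ)
    (hS : ∀ n ∈ S, (n:ℝ) ≤ x ∧ ∃ p a : ℕ, p.Prime ∧ n = p * a ∧ Z < p ∧ a ∈ T.smoothNumbers ∧
      |(sigma1 a : ℝ) / a - ℓ| ≤ ω) :
    (S.card : ℝ) ≤ 15 * B * (x / L) := by
  classical
  let A : Finset ℕ := (Finset.Icc 1 ⌊x⌋₊).filter (fun a => a ∈ T.smoothNumbers ∧
      |(sigma1 a : ℝ) / a - ℓ| ≤ ω ∧ (a:ℝ) * Z ≤ x)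
  have hA : ∀ a, a ∈ A ↔ (1 ≤ a ∧ a ≤ ⌊x⌋₊) ∧ a ∈ T.smoothNumbers ∧
      |(sigma1 a : ℝ) / a - ℓ| ≤ ω ∧ (a:ℝ) * Z ≤ x := by
    intro a; simp only [A, Finset.mem_filter, Finset.mem_Icc]
  have hBA := hB A (fun a ha => ((hA a).1 ha).1.1) (by
    intro k p q hp hq hpk hqk h1 h2
    have h1' := (hA _).1 h1
    have h2' := (hA _).1 h2
    have hk : 1 ≤ k := by
      rcases Nat.eq_zero_or_pos k with h | h
      · subst h; simp at hpk
      · exact h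
    refine uniq hk hp hq hpk hqk h1'.2.2.1 h2'.2.2.1 (D := T) ?_ ?_ hω
    · exact_mod_cast (Nat.mem_smoothNumbers'.1 h1'.2.1 p hp (Dvd.intro _ rfl)).le
    · exact_mod_cast (Nat.mem_smoothNumbers'.1 h2'.2.1 q hq (Dvd.intro _ rfl)).le)
  have hsub : S ⊆ A.biUnion (fun a => (Nat.primesLE ⌊x / a⌋₊).image (fun p => p * a)) := by
    intro n hn
    obtain ⟨hnx, p, a, hp, rfl, hZp, ha, haω⟩ := hS n hn
    have ha0 : 1 ≤ a := Nat.pos_of_ne_zero (Nat.ne_zero_of_mem_smoothNumbers ha)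
    have ha0' : (0:ℝ) < a := by exact_mod_cast ha0
    push_cast at hnx
    simp only [Finset.mem_biUnion, Finset.mem_image, Nat.mem_primesLE]
    refine ⟨a, (hA a).2 ⟨⟨ha0, Nat.le_floor ?_⟩, ha, haω, ?_⟩, p, ⟨Nat.le_floor ?_, hp⟩, rfl⟩
    · nlinarith
    · nlinarith
    · rw [le_div_iff₀ ha0']; exact hnx
  have h1 := (Finset.card_le_card hsub).trans Finset.card_biUnion_le
  have h2 : (S.card : ℝ) ≤ ∑ a ∈ A,
      (((Nat.primesLE ⌊x / a⌋₊).image (fun p => p * a)).card : ℝ) := by exact_mod_cast h1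
  refine h2.trans ?_
  calc _ ≤ ∑ a ∈ A, (15 * (x / L)) * (a:ℝ)⁻¹ := by
        apply Finset.sum_le_sum
        intro a ha
        have ha' := (hA a).1 ha
        have ha0 : (0:ℝ) < a := by exact_mod_cast ha'.1.1
        have hy : Z ≤ x / a := by rw [le_div_iff₀ ha0]; linarith [ha'.2.2.2]
        have h3 : (((Nat.primesLE ⌊x / a⌋₊).image (fun p => p * a)).card : ℝ) ≤
            Nat.primeCounting ⌊x / (a:ℝ)⌋₊ := by
          have h4 : (Nat.primesLE ⌊x / (a:ℝ)⌋₊).card = Nat.primeCounting ⌊x / (a:ℝ)⌋₊ := by simp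
          rw [← h4]
          exact_mod_cast Finset.card_image_le
        refine h3.trans ((pi_upper (by linarith)).trans ?_)
        have h5 : L / 3 ≤ Real.log (x / a) := hLZ.trans (Real.log_le_log (by linarith) hy)
        calc 5 * (x / a) / Real.log (x / a) ≤ 5 * (x / a) / (L / 3) := by gcongr
          _ = (15 * (x / L)) * (a:ℝ)⁻¹ := by field_simp; ring
    _ = (15 * (x / L)) * ∑ a ∈ A, (a:ℝ)⁻¹ := by rw [Finset.mul_sum]
    _ ≤ (15 * (x / L)) * B := by gcongr
    _ = _ := by ring

lemma two_primes {c ℓ x Z : ℝ} {m a p q : ℕ} (hm : 1 ≤ m) (hℓ : ℓ = (sigma1 m : ℝ) / m)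
    (hp : p.Prime) (hq : q.Prime) (ha : 1 ≤ a) (hqa : ¬ q ∣ a) (hpa : ¬ p ∣ q * a)
    (hZp : Z < p) (hZq : Z < q) (hZ : 1 < Z) (hn : ((p * (q * a) : ℕ) : ℝ) ≤ x)
    (hW : |(sigma1 (p * (q * a)) : ℝ) - ℓ * ((p * (q * a) : ℕ) : ℝ)| ≤ x ^ c)
    (hs : (sigma1 a : ℝ) ≤ (ℓ + 1) * a)
    (hZc : x ^ c < Z) (hfin : m * (3 * (ℓ + 1) * (x / Z ^ 2) + 1) < Z) : False := by
  have hm0 : (0:ℝ) < m := by exact_mod_cast hm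
  have ha0 : (1:ℝ) ≤ a := by exact_mod_cast ha
  have hsa : (a:ℝ) ≤ sigma1 a := by exact_mod_cast sig_ge ha
  have hℓ0 : 0 ≤ ℓ := by rw [hℓ]; positivity
  rw [sig_prime_mul hp hpa, sig_prime_mul hq hqa] at hW
  push_cast at hW hn
  set P : ℝ := (p:ℝ)
  set Q : ℝ := (q:ℝ)
  set s : ℝ := (sigma1 a : ℝ) with hsdef
  rw [abs_le] at hW
  have hexp : (P + 1) * ((Q + 1) * s) - ℓ * (P * (Q * a)) = (s - ℓ * a) * (P * Q) + s * (P + Q + 1) := by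
    ring
  rw [hexp] at hW
  have hPQ : 0 < P * Q := by nlinarith
  have hs1 : 1 ≤ s := by linarith
  rcases le_or_gt (ℓ * a) s with h | h
  · have h1 : 0 ≤ (s - ℓ * a) * (P * Q) := mul_nonneg (by linarith) hPQ.le
    have h2 : P ≤ s * (P + Q + 1) := by nlinarith
    linarith [hW.2]
  · have hint : s - ℓ * a ≤ - (1 / m) := by
      have h1 : ((sigma1 a * m : ℕ) : ℝ) < ((sigma1 m * a : ℕ) : ℝ) := by
        push_cast
        rw [hℓ, div_mul_eq_mul_div, lt_div_iff₀ hm0] at h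
        exact h
      have h2 : ((sigma1 a * m + 1 : ℕ) : ℝ) ≤ ((sigma1 m * a : ℕ) : ℝ) := by
        exact_mod_cast h1
      push_cast at h2
      rw [← hsdef] at h2
      rw [hℓ]
      have h3 : s - (sigma1 m : ℝ) / m * a = (s * m - sigma1 m * a) / m := by field_simp
      rw [h3, ← neg_div]
      gcongr
      linarith
    have h4 : P * Q ≤ m * (s * (P + Q + 1) + x ^ c) := by
      have h5 : (s - ℓ * a) * (P * Q) ≤ - (1 / m) * (P * Q) := by gcongr
      have h6 : (1 / m) * (P * Q) ≤ s * (P + Q + 1) + x ^ c := by linarith [hW.1]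
      calc P * Q = m * ((1 / m) * (P * Q)) := by field_simp
        _ ≤ _ := by gcongr
    have haZ : (a:ℝ) ≤ x / Z ^ 2 := by
      rw [le_div_iff₀ (by positivity)]
      have : Z ^ 2 ≤ P * Q := by nlinarith
      nlinarith
    have hsb : 3 * s + 1 ≤ 3 * (ℓ + 1) * (x / Z ^ 2) + 1 := by
      have : (ℓ + 1) * a ≤ (ℓ + 1) * (x / Z ^ 2) := by gcongr
      linarith
    have hmm : m * (3 * s + 1) < Z :=
      lt_of_le_of_lt (by gcongr) hfin
    rcases le_total P Q with hle | hle
    · have h7 : s * (P + Q + 1) + x ^ c ≤ (3 * s + 1) * Q := by nlinarith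
      have h8 : P * Q ≤ (m * (3 * s + 1)) * Q := by
        calc P * Q ≤ _ := h4
          _ ≤ m * ((3 * s + 1) * Q) := by gcongr
          _ = _ := by ring
      have h9 := le_of_mul_le_mul_right h8 (by linarith)
      linarith
    · have h7 : s * (P + Q + 1) + x ^ c ≤ (3 * s + 1) * P := by nlinarith
      have h8 : Q * P ≤ (m * (3 * s + 1)) * P := by
        calc Q * P = P * Q := by ring
          _ ≤ _ := h4
          _ ≤ m * ((3 * s + 1) * P) := by gcongr
          _ = _ := by ring
      have h9 := le_of_mul_le_mul_right h8 (by linarith)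
      linarith

lemma upper_fin {c ℓ x L Z B : ℝ} {T m : ℕ} (hc' : c < 1 / 3) (hc : 0 < c) (hm : 1 ≤ m)
    (hℓ : ℓ = (sigma1 m : ℝ) / m)
    (hx : 1 < x) (hL : 1 ≤ L) (hT : 1 ≤ T) (hTL : L / 4 ≤ T) (hZ : 1 < Z) (hLZ : L / 3 ≤ Real.log Z)
    (hr : 2 * (x / L) ^ (c - 1) * Z ^ 2 < 1)
    (hω : 2 * ((ℓ + 2) / Z) * (T:ℝ) ^ 2 < 1)
    (hZc : x ^ c < Z) (hfin : m * (3 * (ℓ + 1) * (x / Z ^ 2) + 1) < Z)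
    (hsm : (2:ℝ) ^ T * Real.sqrt x ≤ x / L)
    (hB : ∀ A : Finset ℕ, (∀ a ∈ A, 1 ≤ a) →
    (∀ k p q : ℕ, p.Prime → q.Prime → ¬ p ∣ k → ¬ q ∣ k → p * k ∈ A → q * k ∈ A → p = q) →
    ∑ a ∈ A, (a:ℝ)⁻¹ ≤ B) :
    ((WW c ℓ x).ncard : ℝ) ≤ (14 + 15 * B) * (x / L) := by
  classical
  have hx0 : 0 < x := by linarith
  have hL0 : 0 < L := by linarith
  have hT0 : (0:ℝ) < T := by exact_mod_cast hT
  have hxL : 0 < x / L := by positivity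
  have hfinW := WW_fin c ℓ x
  have hℓ1 : 1 ≤ ℓ := by rw [hℓ]; exact sdiv_ge hm
  rw [Set.ncard_eq_toFinset_card _ hfinW]
  set W := hfinW.toFinset with hWdef
  set r := (x / L) ^ (c - 1) with hrdef
  have hr0 : 0 < r := by positivity
  have hrZ : r ≤ 1 / Z := by
    rw [le_div_iff₀ (by linarith)]
    nlinarith
  have hr1 : r ≤ 1 := hrZ.trans (by rw [div_le_one (by linarith)]; exact hZ.le)
  let p1 : ℕ → Prop := fun n => ∃ p : ℕ, p.Prime ∧ T ≤ p ∧ (p:ℝ) ≤ Z ∧ p ∣ n ∧ ¬ p ∣ n / p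
  let p2 : ℕ → Prop := fun n => ∃ p : ℕ, T ≤ p ∧ p ^ 2 ∣ n
  let p4 : ℕ → Prop := fun n => ∃ p a : ℕ, p.Prime ∧ n = p * a ∧ Z < p ∧ a ∈ T.smoothNumbers ∧
      |(sigma1 a : ℝ) / a - ℓ| ≤ (ℓ + 2) / Z
  let W0 := W.filter (fun n : ℕ => (n:ℝ) ≤ x / L)
  let W1 := W.filter (fun n : ℕ => x / L < (n:ℝ) ∧ p1 n)
  let W2 := W.filter p2
  let W3 := W.filter (fun n => n ∈ T.smoothNumbers)
  let W4 := W.filter p4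
  have hW : ∀ n ∈ W, 1 ≤ n ∧ (n:ℝ) ≤ x ∧ |(sigma1 n : ℝ) - ℓ * n| < (n : ℝ) ^ c := by
    intro n hn
    exact (Set.Finite.mem_toFinset hfinW).1 hn
  have hWr : ∀ n ∈ W, x / L < (n:ℝ) → |(sigma1 n : ℝ) / n - ℓ| ≤ r := by
    intro n hn hnx
    obtain ⟨h1, h2, h3⟩ := hW n hn
    have hn0 : (0:ℝ) < n := by exact_mod_cast h1
    have : (sigma1 n : ℝ) / n - ℓ = ((sigma1 n : ℝ) - ℓ * n) / n := by field_simp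
    rw [this, abs_div, abs_of_pos hn0]
    calc |(sigma1 n : ℝ) - ℓ * n| / n ≤ (n:ℝ) ^ c / n := by gcongr
      _ = (n:ℝ) ^ (c - 1) := by rw [Real.rpow_sub_one hn0.ne']
      _ ≤ r := Real.rpow_le_rpow_of_nonpos hxL hnx.le (by linarith)
  have hcover : W ⊆ W0 ∪ W1 ∪ W2 ∪ W3 ∪ W4 := by
    intro n hn
    simp only [Finset.mem_union, W0, W1, W2, W3, W4, Finset.mem_filter, hn, true_and]
    by_contra! hcon
    obtain ⟨⟨⟨⟨g0, g1⟩, g2⟩, g3⟩, g4⟩ := hcon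
    have g1 := g1 g0
    obtain ⟨h1, h2, h3⟩ := hW n hn
    have hr' := hWr n hn g0
    have big : ∀ p : ℕ, p.Prime → T ≤ p → p ∣ n → ¬ p ∣ n / p ∧ Z < p := by
      intro p hp hTp hpn
      have hnd : ¬ p ∣ n / p := by
        intro hd
        apply g2
        refine ⟨p, hTp, ?_⟩
        rw [pow_two]
        exact (Nat.dvd_div_iff_mul_dvd hpn).1 hd
      refine ⟨hnd, ?_⟩
      by_contra! hle
      exact g1 ⟨p, hp, hTp, hle, hpn, hnd⟩
    have ex : ∀ k : ℕ, k ∉ T.smoothNumbers → ∃ p : ℕ, p.Prime ∧ T ≤ p ∧ p ∣ k := by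
      intro k hk
      rw [Nat.mem_smoothNumbers'] at hk
      push Not at hk
      obtain ⟨p, hp, hpk, hT⟩ := hk
      exact ⟨p, hp, hT, hpk⟩
    obtain ⟨p, hp, hTp, k, rfl⟩ := ex n g3
    obtain ⟨hnd, hZp⟩ := big p hp hTp (Dvd.intro _ rfl)
    rw [Nat.mul_div_cancel_left _ hp.pos] at hnd
    have hk : 1 ≤ k := Nat.pos_of_ne_zero (by rintro rfl; simp at hnd)
    have hp0 : (0:ℝ) < p := by exact_mod_cast hp.pos
    rw [sdiv_prime hp hnd hk] at hr'
    have hsk1 := sdiv_ge hk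
    have hsk : (sigma1 k : ℝ) / k ≤ ℓ + 1 := by
      have h5 := (abs_le.1 hr').2
      have : 0 ≤ 1 / (p:ℝ) * ((sigma1 k : ℝ) / k) := by positivity
      linarith
    by_cases hks : k ∈ T.smoothNumbers
    · refine g4 ⟨p, k, hp, rfl, hZp, hks, ?_⟩
      have h6 : 1 / (p:ℝ) * ((sigma1 k : ℝ) / k) ≤ 1 / Z * (ℓ + 1) := by gcongr
      have h7 : 0 ≤ 1 / (p:ℝ) * ((sigma1 k : ℝ) / k) := by positivity
      have h8 : (ℓ + 2) / Z = 1 / Z + 1 / Z * (ℓ + 1) := by ring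
      have h9 : 0 < 1 / Z := by positivity
      rw [abs_le] at hr' ⊢
      constructor
      · rw [h8]; linarith [hr'.1]
      · rw [h8]; linarith [hr'.2]
    · obtain ⟨q, hq, hTq, a, rfl⟩ := ex k hks
      obtain ⟨hnd2, hZq⟩ := big q hq hTq ⟨p * a, by ring⟩
      have hqa : ¬ q ∣ a := by
        intro hd
        apply hnd2
        rw [show p * (q * a) = q * (p * a) by ring, Nat.mul_div_cancel_left _ hq.pos]
        exact hd.mul_left p
      have ha : 1 ≤ a := Nat.pos_of_ne_zero (by rintro rfl; simp at hqa)
      have ha0 : (0:ℝ) < a := by exact_mod_cast ha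
      have hsa : (sigma1 a : ℝ) ≤ (ℓ + 1) * a := by
        rw [sdiv_prime hq hqa ha] at hsk
        have := sdiv_ge ha
        have h5 : 0 ≤ 1 / (q:ℝ) * ((sigma1 a : ℝ) / a) := by positivity
        have h6 : (sigma1 a : ℝ) / a ≤ ℓ + 1 := by linarith
        rwa [div_le_iff₀ ha0] at h6
      refine two_primes (c := c) hm hℓ hp hq ha hqa hnd hZp hZq hZ h2 ?_ hsa hZc hfin
      exact h3.le.trans (Real.rpow_le_rpow (by positivity) h2 hc.le)
  have c0 : (W0.card : ℝ) ≤ x / L := by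
    have hsub : W0 ⊆ Finset.Icc 1 ⌊x / L⌋₊ := by
      intro n hn
      simp only [W0, Finset.mem_filter] at hn
      rw [Finset.mem_Icc]
      exact ⟨(hW n hn.1).1, Nat.le_floor hn.2⟩
    have := Finset.card_le_card hsub
    rw [Nat.card_Icc] at this
    calc (W0.card : ℝ) ≤ ⌊x / L⌋₊ := by exact_mod_cast (by omega)
      _ ≤ _ := Nat.floor_le hxL.le
  have hxT : x / T ≤ 4 * (x / L) := by
    calc x / T ≤ x / (L / 4) := by gcongr
      _ = _ := by field_simp
  have c1 : (W1.card : ℝ) ≤ 4 * (x / L) := by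
    refine (card_W1 (ℓ := ℓ) hT hx0 hr W1 ?_).trans hxT
    intro n hn
    simp only [W1, Finset.mem_filter] at hn
    exact ⟨(hW n hn.1).1, (hW n hn.1).2.1, hWr n hn.1 hn.2.1, hn.2.2⟩
  have c2 : (W2.card : ℝ) ≤ 8 * (x / L) := by
    have := card_W2 hT hx0 W2 (by
      intro n hn
      simp only [W2, Finset.mem_filter] at hn
      exact ⟨(hW n hn.1).1, (hW n hn.1).2.1, hn.2⟩)
    rw [mul_div_assoc] at this
    linarith
  have c3 : (W3.card : ℝ) ≤ x / L := by
    have hsub : W3 ⊆ Nat.smoothNumbersUpTo ⌊x⌋₊ T := by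
      intro n hn
      simp only [W3, Finset.mem_filter] at hn
      rw [Nat.mem_smoothNumbersUpTo]
      exact ⟨Nat.le_floor (hW n hn.1).2.1, hn.2⟩
    have h1 := (Finset.card_le_card hsub).trans (Nat.smoothNumbersUpTo_card_le _ _)
    have h2 : (W3.card : ℝ) ≤ (2:ℝ) ^ (T.primesBelow.card) * (Nat.sqrt ⌊x⌋₊ : ℝ) := by
      exact_mod_cast h1
    refine h2.trans (le_trans ?_ hsm)
    gcongr
    · norm_num
    · calc T.primesBelow.card ≤ (Finset.range T).card := Finset.card_le_card (Finset.filter_subset _ _)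
        _ = T := Finset.card_range T
    · refine Real.nat_sqrt_le_real_sqrt.trans ?_
      exact Real.sqrt_le_sqrt (Nat.floor_le hx0.le)
  have c4 : (W4.card : ℝ) ≤ 15 * B * (x / L) := by
    refine card_W4 (ℓ := ℓ) (ω := (ℓ + 2) / Z) hZ hL0 hLZ hx0 hω hB W4 ?_
    intro n hn
    simp only [W4, Finset.mem_filter] at hn
    exact ⟨(hW n hn.1).2.1, hn.2⟩
  have hc5 : W.card ≤ W0.card + W1.card + W2.card + W3.card + W4.card := by
    refine (Finset.card_le_card hcover).trans ?_
    refine (Finset.card_union_le _ _).trans ?_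
    gcongr
    refine (Finset.card_union_le _ _).trans ?_
    gcongr
    refine (Finset.card_union_le _ _).trans ?_
    gcongr
    exact Finset.card_union_le _ _
  have hc6 : (W.card : ℝ) ≤ W0.card + W1.card + W2.card + W3.card + W4.card := by exact_mod_cast hc5
  linarith

lemma ev_log (K e : ℝ) (he : 0 < e) : ∀ᶠ x : ℝ in Filter.atTop, K * Real.log x < x ^ e := by
  have := (isLittleO_log_rpow_atTop he).bound (c := 1 / (|K| + 1)) (by positivity)
  filter_upwards [this, Filter.eventually_gt_atTop 1] with x h hx
  have hl := Real.log_pos hx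
  have hxe : 0 < x ^ e := Real.rpow_pos_of_pos (by linarith) e
  rw [Real.norm_of_nonneg hl.le, Real.norm_of_nonneg hxe.le, one_div, inv_mul_eq_div,
    le_div_iff₀ (by positivity)] at h
  nlinarith [le_abs_self K]

lemma upper_bound (c : ℝ) (hc : 0 < c) (hc' : c < 1 / 3) (m : ℕ) (hm : 1 ≤ m) :
    ∃ C : ℝ, ∀ᶠ x : ℝ in Filter.atTop,
      ((WW c ((sigma1 m : ℝ) / m) x).ncard : ℝ) / (x / Real.log x) ≤ C := by
  obtain ⟨B, hB0, hB⟩ := sumA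
  refine ⟨14 + 15 * B, ?_⟩
  set ℓ := (sigma1 m : ℝ) / m with hℓ
  have hℓ1 : 1 ≤ ℓ := sdiv_ge hm
  have hm0 : (0:ℝ) < m := by exact_mod_cast hm
  set θ : ℝ := 5 / 12 - c / 4 with hθ
  filter_upwards [Filter.eventually_gt_atTop 1,
    Real.tendsto_log_atTop.eventually (Filter.eventually_ge_atTop 8),
    ev_log 2 ((1/3 - c) / 2) (by linarith),
    ev_log (2 * (ℓ + 2)) (θ / 2) (by linarith),
    ev_log (m * (3 * (ℓ + 1) + 1)) (3 * θ - 1) (by linarith),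
    ev_log 1 0.15 (by norm_num)] with x hx hL8 e1 e2 e3 e4
  set L := Real.log x with hLdef
  have hx0 : 0 < x := by linarith
  have hL0 : 0 < L := by linarith
  have hxL : 0 < x / L := by positivity
  rw [div_le_iff₀ hxL]
  set T := ⌊L / 2⌋₊ with hT
  have hT1 : (T:ℝ) ≤ L / 2 := Nat.floor_le (by positivity)
  have hT2 : L / 2 < T + 1 := Nat.lt_floor_add_one _
  have hT3 : (1:ℝ) ≤ T := by linarith
  set Z := x ^ θ with hZdef
  have hZ0 : 0 < Z := by positivity
  have hZ2 : Z ^ 2 = x ^ (2 * θ) := by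
    rw [hZdef, ← Real.rpow_natCast, ← Real.rpow_mul hx0.le]; congr 1; push_cast; ring
  refine upper_fin (L := L) (Z := Z) (T := T) (m := m) hc' hc hm hℓ hx (by linarith)
    (by exact_mod_cast hT3) (by linarith) (Real.one_lt_rpow hx (by linarith)) ?_ ?_ ?_ ?_ ?_ ?_ hB
  · rw [hZdef, Real.log_rpow hx0, ← hLdef]; nlinarith
  · rw [hZ2, Real.div_rpow hx0.le hL0.le]
    have h1 : L ^ (c - 1) ≥ L⁻¹ := by
      rw [← Real.rpow_neg_one]
      exact Real.rpow_le_rpow_of_exponent_le (by linarith) (by linarith)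
    have h2 : x ^ (c - 1) / L ^ (c - 1) ≤ x ^ (c - 1) * L := by
      calc x ^ (c - 1) / L ^ (c - 1) ≤ x ^ (c - 1) / L⁻¹ := by gcongr
        _ = _ := by rw [div_inv_eq_mul]
    calc 2 * (x ^ (c - 1) / L ^ (c - 1)) * x ^ (2 * θ)
        ≤ 2 * (x ^ (c - 1) * L) * x ^ (2 * θ) := by gcongr
      _ = (2 * L) * (x ^ (c - 1) * x ^ (2 * θ)) := by ring
      _ < x ^ ((1/3 - c) / 2) * (x ^ (c - 1) * x ^ (2 * θ)) := by gcongr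
      _ = 1 := by
        rw [← Real.rpow_add hx0, ← Real.rpow_add hx0, hθ]
        ring_nf
        exact Real.rpow_zero x
  · have h1 : Z = x ^ (θ / 2) * x ^ (θ / 2) := by rw [← Real.rpow_add hx0, add_halves]
    rw [mul_div_assoc', div_mul_eq_mul_div, div_lt_one hZ0]
    have h2 : (2 * (ℓ + 2) * L) * (2 * (ℓ + 2) * L) < Z := by
      rw [h1]; gcongr
    have h3 : (T:ℝ) ^ 2 ≤ L ^ 2 := by gcongr; linarith
    have h4 : (2 * (ℓ + 2)) * L ^ 2 ≤ (2 * (ℓ + 2) * L) * (2 * (ℓ + 2) * L) := by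
      have : 0 < (2 * (ℓ + 2)) * L ^ 2 := by positivity
      nlinarith
    have h5 : 2 * (ℓ + 2) * (T:ℝ) ^ 2 ≤ 2 * (ℓ + 2) * L ^ 2 := by gcongr
    linarith
  · exact Real.rpow_lt_rpow_of_exponent_lt hx (by linarith)
  · have h1 : x / Z ^ 2 = x ^ (1 - 2 * θ) := by
      rw [hZ2, Real.rpow_sub hx0, Real.rpow_one]
    rw [h1]
    have h2 : 1 ≤ x ^ (1 - 2 * θ) := Real.one_le_rpow hx.le (by linarith)
    have h3 : m * (3 * (ℓ + 1) + 1) < x ^ (3 * θ - 1) := by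
      have : 0 < m * (3 * (ℓ + 1) + 1) := by positivity
      nlinarith
    calc m * (3 * (ℓ + 1) * x ^ (1 - 2 * θ) + 1)
        ≤ m * (3 * (ℓ + 1) * x ^ (1 - 2 * θ) + x ^ (1 - 2 * θ)) := by gcongr
      _ = m * (3 * (ℓ + 1) + 1) * x ^ (1 - 2 * θ) := by ring
      _ < x ^ (3 * θ - 1) * x ^ (1 - 2 * θ) := by gcongr
      _ = Z := by rw [← Real.rpow_add hx0, hZdef]; congr 1; ring
  · have h1 : (2:ℝ) ^ T ≤ x ^ (0.35 : ℝ) := by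
      rw [← Real.rpow_natCast, Real.rpow_def_of_pos (by norm_num), Real.rpow_def_of_pos hx0]
      apply Real.exp_le_exp.2
      rw [← hLdef]
      have := Real.log_two_lt_d9
      nlinarith
    rw [le_div_iff₀ hL0, Real.sqrt_eq_rpow]
    calc (2:ℝ) ^ T * x ^ (1/2 : ℝ) * L ≤ x ^ (0.35 : ℝ) * x ^ (1/2 : ℝ) * x ^ (0.15 : ℝ) := by
          gcongr; linarith
      _ = x := by
        rw [← Real.rpow_add hx0, ← Real.rpow_add hx0]; norm_num

theorem stmt_16 (c : ℝ) (hc : 0 < c) (hc' : c < 1 / 3) (F : ℝ → ℝ)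
    (hF : ∀ ℓ : ℝ, F ℓ = Filter.limsup (fun x : ℝ =>
        ({n : ℕ | 1 ≤ n ∧ (n : ℝ) ≤ x ∧
            |(sigma1 n : ℝ) - ℓ * n| < (n : ℝ) ^ c}.ncard : ℝ) / (x / Real.log x))
      Filter.atTop) :
    ∀ ℓ ∈ Set.Ici (1 : ℝ),
      ℓ ∈ closure {ℓ' : ℝ | ℓ' ∈ Set.Ici (1 : ℝ) ∧
        ¬ ContinuousWithinAt F (Set.Ici (1 : ℝ)) ℓ'} := by
  intro ℓ hℓ
  rw [Set.mem_Ici] at hℓ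
  rw [Metric.mem_closure_iff]
  intro ε hε
  obtain ⟨m, hm, h1, h2⟩ := sigma_dense ℓ hℓ ε hε
  set u : ℝ := (sigma1 m : ℝ) / m with hu
  have hu1 : 1 ≤ u := hℓ.trans h1
  refine ⟨u, ⟨hu1, ?_⟩, ?_⟩
  swap
  · rw [dist_comm, Real.dist_eq, abs_of_nonneg (by linarith)]; linarith
  intro hcont
  obtain ⟨δ, hδ, hlow⟩ := lower_bound c hc m hm
  obtain ⟨C, hup⟩ := upper_bound c hc hc' m hm
  have hpos : δ ≤ F u := by
    rw [hF]
    exact Filter.le_limsup_of_frequently_le hlow.frequently ⟨C, Filter.eventually_map.2 hup⟩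
  have hev : ∀ᶠ v in nhdsWithin u (Set.Ici 1), 0 < F v :=
    hcont.eventually (lt_mem_nhds (hδ.trans_le hpos))
  obtain ⟨η, hη, hη2⟩ := Metric.mem_nhdsWithin_iff.1 hev
  have hae := ae_bound c hc'
  have hdense := MeasureTheory.Measure.dense_of_ae hae
  obtain ⟨v, hv, hvI⟩ := hdense.exists_between (show u < u + η by linarith)
  obtain ⟨C', hC'⟩ := hv
  have hz : F v = 0 := by rw [hF]; exact limsup_zero c v C' hC'
  have := hη2 (show v ∈ Metric.ball u η ∩ Set.Ici 1 from
    ⟨by rw [Metric.mem_ball, Real.dist_eq, abs_of_pos (by linarith [hvI.1])]; linarith [hvI.2],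
     by rw [Set.mem_Ici]; linarith [hvI.1]⟩)
  simp only [Set.mem_ofPred_eq] at this
  linarith
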